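/- arXiv:2002.09163 — 2 statements merged into one kernel-verified Lean document; each statement's English description precedes it below -/
import Mathlib

section
/- (Strip uniqueness, core of Theorem 4.1.) Let D₁, D₂ ⊂ ℝ³ be nonempty bounded open sets, let a ∈ ℝ³ with a ≠ 0, and let 0 < k_min < k_max. Suppose that ∫_{D₁} e^{i k (a·y)} dy = ∫_{D₂} e^{i k (a·y)} dy for every k ∈ [k_min, k_max]. Then sup_{y ∈ D₁} a·y = sup_{y ∈ D₂} a·y and inf_{y ∈ D₁} a·y = inf_{y ∈ D₂} a·y; equivalently, the smallest strips with normal a containing D₁ and D₂ coincide: {y ∈ ℝ³ : inf_{z ∈ D₁} a·z ≤ a·y ≤ sup_{z ∈ D₁} a·z} = {y ∈ ℝ³ : inf_{z ∈ D₂} a·z ≤ a·y ≤ sup_{z ∈ D₂} a·z}. -/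
open MeasureTheory Complex RealInnerProductSpace

/-- Bounded open sets: the exponential moments of a linear functional all exist. -/
lemma strip_expSet (D : Set (EuclideanSpace ℝ (Fin 3))) (hb : Bornology.IsBounded D)
    (a : EuclideanSpace ℝ (Fin 3)) :
    ProbabilityTheory.integrableExpSet (fun y => (⟪a, y⟫ : ℝ)) (volume.restrict D) = Set.univ := by
  refine Set.eq_univ_of_forall fun t => ?_
  have hc : Continuous (fun y : EuclideanSpace ℝ (Fin 3) => Real.exp (t * (⟪a, y⟫ : ℝ))) := by
    fun_prop
  have h1 : IntegrableOn (fun y : EuclideanSpace ℝ (Fin 3) => Real.exp (t * (⟪a, y⟫ : ℝ)))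
      (closure D) volume := hc.continuousOn.integrableOn_compact hb.isCompact_closure
  exact h1.mono_set subset_closure

lemma strip_map_eq (D₁ D₂ : Set (EuclideanSpace ℝ (Fin 3)))
    (hD₁b : Bornology.IsBounded D₁) (hD₂b : Bornology.IsBounded D₂)
    (a : EuclideanSpace ℝ (Fin 3))
    (kmin kmax : ℝ) (hkk : kmin < kmax)
    (h : ∀ k ∈ Set.Icc kmin kmax,
      (∫ y in D₁, Complex.exp (I * k * (⟪a, y⟫ : ℝ)))
        = ∫ y in D₂, Complex.exp (I * k * (⟪a, y⟫ : ℝ))) :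
    (volume.restrict D₁).map (fun y => (⟪a, y⟫ : ℝ))
      = (volume.restrict D₂).map (fun y => (⟪a, y⟫ : ℝ)) := by
  have : IsFiniteMeasure (volume.restrict D₁) :=
    isFiniteMeasure_restrict.2 hD₁b.measure_lt_top.ne
  have : IsFiniteMeasure (volume.restrict D₂) :=
    isFiniteMeasure_restrict.2 hD₂b.measure_lt_top.ne
  have hX : Measurable (fun y : EuclideanSpace ℝ (Fin 3) => (⟪a, y⟫ : ℝ)) := by fun_prop
  refine Measure.ext_of_complexMGF_eq hX.aemeasurable hX.aemeasurable ?_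
  have han : ∀ D : Set (EuclideanSpace ℝ (Fin 3)), Bornology.IsBounded D →
      AnalyticOnNhd ℂ (ProbabilityTheory.complexMGF (fun y => (⟪a, y⟫ : ℝ))
        (volume.restrict D)) Set.univ := by
    intro D hb z _
    refine ProbabilityTheory.analyticAt_complexMGF ?_
    rw [strip_expSet D hb a]
    simp
  refine (han D₁ hD₁b).eq_of_frequently_eq (han D₂ hD₂b) (z₀ := I * kmin) ?_
  have hlim : Filter.Tendsto (fun k : ℝ => I * (k : ℂ)) (nhdsWithin kmin (Set.Ioi kmin))
      (nhdsWithin (I * kmin) {I * (kmin : ℂ)}ᶜ) := by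
    refine tendsto_nhdsWithin_iff.2 ⟨?_, ?_⟩
    · have : Continuous (fun k : ℝ => I * (k : ℂ)) := by fun_prop
      exact (this.tendsto kmin).mono_left nhdsWithin_le_nhds
    · filter_upwards [self_mem_nhdsWithin] with k hk
      simpa using (ne_of_gt hk : k ≠ kmin)
  refine hlim.frequently (Filter.Eventually.frequently ?_)
  filter_upwards [Ioo_mem_nhdsGT hkk] with k hk
  exact h k ⟨hk.1.le, hk.2.le⟩

lemma strip_subset (D₁ D₂ : Set (EuclideanSpace ℝ (Fin 3)))
    (hD₁o : IsOpen D₁) (a : EuclideanSpace ℝ (Fin 3))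
    (h : (volume.restrict D₁).map (fun y => (⟪a, y⟫ : ℝ))
      = (volume.restrict D₂).map (fun y => (⟪a, y⟫ : ℝ))) :
    (fun y => (⟪a, y⟫ : ℝ)) '' D₁ ⊆ closure ((fun y => (⟪a, y⟫ : ℝ)) '' D₂) := by
  rintro _ ⟨y, hy, rfl⟩
  by_contra hn
  have hc : Continuous (fun y : EuclideanSpace ℝ (Fin 3) => (⟪a, y⟫ : ℝ)) := by fun_prop
  set U := (closure ((fun y => (⟪a, y⟫ : ℝ)) '' D₂))ᶜ with hU
  have hUo : IsOpen U := isClosed_closure.isOpen_compl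
  have e := congrArg (fun m => m U) h
  simp only [Measure.map_apply hc.measurable hUo.measurableSet] at e
  have hp := hUo.preimage hc
  rw [Measure.restrict_apply hp.measurableSet, Measure.restrict_apply hp.measurableSet] at e
  have h0 : (fun y => (⟪a, y⟫ : ℝ)) ⁻¹' U ∩ D₂ = ∅ := by
    ext z
    simp only [Set.mem_inter_iff, Set.mem_empty_iff_false, iff_false, not_and]
    intro hz hz2
    exact hz (subset_closure ⟨z, hz2, rfl⟩)
  rw [h0, measure_empty] at e
  exact ((hp.inter hD₁o).measure_pos volume ⟨y, hn, hy⟩).ne' e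

/-- strip uniqueness, core of Theorem 4.1: if the integrals
`∫_{D₁} e^{ik(a·y)} dy` and `∫_{D₂} e^{ik(a·y)} dy` coincide for all `k` in the band
`[k_min, k_max]`, then `sup_{y∈D₁} a·y = sup_{y∈D₂} a·y`, `inf_{y∈D₁} a·y = inf_{y∈D₂} a·y`,
and the smallest strips with normal `a` containing `D₁` and `D₂` coincide. -/
theorem strip_uniqueness
    (D₁ D₂ : Set (EuclideanSpace ℝ (Fin 3)))
    (hD₁ne : D₁.Nonempty) (hD₁o : IsOpen D₁) (hD₁b : Bornology.IsBounded D₁)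
    (hD₂ne : D₂.Nonempty) (hD₂o : IsOpen D₂) (hD₂b : Bornology.IsBounded D₂)
    (a : EuclideanSpace ℝ (Fin 3)) (ha : a ≠ 0)
    (kmin kmax : ℝ) (hk0 : 0 < kmin) (hkk : kmin < kmax)
    (h : ∀ k ∈ Set.Icc kmin kmax,
      (∫ y in D₁, Complex.exp (I * k * (⟪a, y⟫ : ℝ)))
        = ∫ y in D₂, Complex.exp (I * k * (⟪a, y⟫ : ℝ))) :
    (sSup ((fun y => (⟪a, y⟫ : ℝ)) '' D₁) = sSup ((fun y => (⟪a, y⟫ : ℝ)) '' D₂) ∧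
      sInf ((fun y => (⟪a, y⟫ : ℝ)) '' D₁) = sInf ((fun y => (⟪a, y⟫ : ℝ)) '' D₂)) ∧
    {y : EuclideanSpace ℝ (Fin 3) |
        sInf ((fun z => (⟪a, z⟫ : ℝ)) '' D₁) ≤ ⟪a, y⟫ ∧
          (⟪a, y⟫ : ℝ) ≤ sSup ((fun z => (⟪a, z⟫ : ℝ)) '' D₁)} =
      {y : EuclideanSpace ℝ (Fin 3) |
        sInf ((fun z => (⟪a, z⟫ : ℝ)) '' D₂) ≤ ⟪a, y⟫ ∧
          (⟪a, y⟫ : ℝ) ≤ sSup ((fun z => (⟪a, z⟫ : ℝ)) '' D₂)} := by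
  have hm := strip_map_eq D₁ D₂ hD₁b hD₂b a kmin kmax hkk h
  have hcl : closure ((fun y => (⟪a, y⟫ : ℝ)) '' D₁) = closure ((fun y => (⟪a, y⟫ : ℝ)) '' D₂) :=
    (closure_minimal (strip_subset D₁ D₂ hD₁o a hm) isClosed_closure).antisymm
      (closure_minimal (strip_subset D₂ D₁ hD₂o a hm.symm) isClosed_closure)
  have hc : Continuous (fun y : EuclideanSpace ℝ (Fin 3) => (⟪a, y⟫ : ℝ)) := by fun_prop
  have hbd : ∀ D : Set (EuclideanSpace ℝ (Fin 3)), Bornology.IsBounded D →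
      Bornology.IsBounded ((fun y => (⟪a, y⟫ : ℝ)) '' D) := fun D hb =>
    ((hb.isCompact_closure.image hc).isBounded).subset (Set.image_mono subset_closure)
  have hS : sSup ((fun y => (⟪a, y⟫ : ℝ)) '' D₁) = sSup ((fun y => (⟪a, y⟫ : ℝ)) '' D₂) := by
    have h1 := isLUB_csSup (hD₁ne.image _) (hbd D₁ hD₁b).bddAbove
    have h2 := isLUB_csSup (hD₂ne.image _) (hbd D₂ hD₂b).bddAbove
    rw [IsLUB, ← upperBounds_closure] at h1 h2
    rw [hcl] at h1
    exact h1.unique h2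
  have hI : sInf ((fun y => (⟪a, y⟫ : ℝ)) '' D₁) = sInf ((fun y => (⟪a, y⟫ : ℝ)) '' D₂) := by
    have h1 := isGLB_csInf (hD₁ne.image _) (hbd D₁ hD₁b).bddBelow
    have h2 := isGLB_csInf (hD₂ne.image _) (hbd D₂ hD₂b).bddBelow
    rw [IsGLB, ← lowerBounds_closure] at h1 h2
    rw [hcl] at h1
    exact h1.unique h2
  exact ⟨⟨hS, hI⟩, by rw [hS, hI]⟩
end

section
/- (Corollary on the parallel hexahedron.) Let D₁, D₂ ⊂ ℝ³ be nonempty bounded open sets, let a₁, a₂, a₃ ∈ ℝ³ be linearly independent, and let 0 < k_min < k_max. Suppose that for each j ∈ {1,2,3}, ∫_{D₁} e^{i k (aⱼ·y)} dy = ∫_{D₂} e^{i k (aⱼ·y)} dy for every k ∈ [k_min, k_max]. Then the smallest parallel hexahedra with face normals a₁, a₂, a₃ containing D₁ and D₂ coincide: ⋂_{j=1}^{3} S_{D₁}(aⱼ) = ⋂_{j=1}^{3} S_{D₂}(aⱼ), where S_D(a) := {y ∈ ℝ³ : inf_{z ∈ D} a·z ≤ a·y ≤ sup_{z ∈ D}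 a·z}. -/
open MeasureTheory Complex RealInnerProductSpace

/-- The `a`-strip hull of a set `D ⊆ ℝ³`:
`S_D(a) = {y : inf_{z∈D} a·z ≤ a·y ≤ sup_{z∈D} a·z}`. -/
def stripHull (D : Set (EuclideanSpace ℝ (Fin 3))) (a : EuclideanSpace ℝ (Fin 3)) :
    Set (EuclideanSpace ℝ (Fin 3)) :=
  {y | sInf ((fun z => (⟪a, z⟫ : ℝ)) '' D) ≤ ⟪a, y⟫ ∧
        (⟪a, y⟫ : ℝ) ≤ sSup ((fun z => (⟪a, z⟫ : ℝ)) '' D)}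

theorem helper_complexMGF (D : Set (EuclideanSpace ℝ (Fin 3))) (hDo : IsOpen D)
    (hDb : Bornology.IsBounded D) (a : EuclideanSpace ℝ (Fin 3)) :
    AnalyticOnNhd ℂ (ProbabilityTheory.complexMGF (fun y => (⟪a, y⟫ : ℝ))
      (volume.restrict D)) Set.univ := by
  haveI : IsFiniteMeasure (volume.restrict D) :=
    ⟨by rw [Measure.restrict_apply_univ]; exact hDb.measure_lt_top⟩
  obtain ⟨R, hR⟩ := hDb.exists_norm_le
  have hset : ProbabilityTheory.integrableExpSet (fun y => (⟪a, y⟫ : ℝ))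
      (volume.restrict D) = Set.univ := by
    ext t
    simp only [Set.mem_univ, iff_true]
    refine ProbabilityTheory.integrable_exp_mul_of_mem_Icc (a := -(‖a‖ * R)) (b := ‖a‖ * R) ?_ ?_
    · exact (by fun_prop : Continuous fun y => (⟪a, y⟫ : ℝ)).aemeasurable
    · filter_upwards [ae_restrict_mem hDo.measurableSet] with y hy
      have h1 := abs_real_inner_le_norm a y
      have h2 := mul_le_mul_of_nonneg_left (hR y hy) (norm_nonneg a)
      exact abs_le.mp (h1.trans h2)
  have := ProbabilityTheory.analyticOnNhd_complexMGF (X := fun y => (⟪a, y⟫ : ℝ))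
    (μ := volume.restrict D)
  simpa [hset] using this

theorem helper_map (D₁ D₂ : Set (EuclideanSpace ℝ (Fin 3)))
    (hD₁o : IsOpen D₁) (hD₁b : Bornology.IsBounded D₁)
    (hD₂o : IsOpen D₂) (hD₂b : Bornology.IsBounded D₂)
    (a : EuclideanSpace ℝ (Fin 3)) (kmin kmax : ℝ) (hkk : kmin < kmax)
    (h : ∀ k ∈ Set.Icc kmin kmax,
      (∫ y in D₁, Complex.exp (I * k * (⟪a, y⟫ : ℝ)))
        = ∫ y in D₂, Complex.exp (I * k * (⟪a, y⟫ : ℝ))) :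
    (volume.restrict D₁).map (fun y => (⟪a, y⟫ : ℝ))
      = (volume.restrict D₂).map (fun y => (⟪a, y⟫ : ℝ)) := by
  haveI : IsFiniteMeasure (volume.restrict D₁) :=
    ⟨by rw [Measure.restrict_apply_univ]; exact hD₁b.measure_lt_top⟩
  haveI : IsFiniteMeasure (volume.restrict D₂) :=
    ⟨by rw [Measure.restrict_apply_univ]; exact hD₂b.measure_lt_top⟩
  have hc : Continuous fun y => (⟪a, y⟫ : ℝ) := by fun_prop
  refine Measure.ext_of_complexMGF_eq hc.aemeasurable hc.aemeasurable ?_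
  have key := (helper_complexMGF D₁ hD₁o hD₁b a).eqOn_of_preconnected_of_frequently_eq
    (helper_complexMGF D₂ hD₂o hD₂b a) isPreconnected_univ (z₀ := I * (kmin : ℂ))
    (Set.mem_univ _) ?_
  · ext z
    exact key (Set.mem_univ z)
  · have ht : Filter.Tendsto (fun k : ℝ => I * (k : ℂ)) (nhdsWithin kmin (Set.Ioi kmin))
        (nhdsWithin (I * (kmin : ℂ)) {I * (kmin : ℂ)}ᶜ) := by
      refine tendsto_nhdsWithin_iff.mpr ⟨?_, ?_⟩
      · exact ((by fun_prop : Continuous fun k : ℝ => I * (k : ℂ)).tendsto kmin).mono_left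
          nhdsWithin_le_nhds
      · filter_upwards [self_mem_nhdsWithin] with k hk
        simpa using (ne_of_gt hk : k ≠ kmin)
    refine ht.frequently (Filter.Eventually.frequently ?_)
    filter_upwards [Ioc_mem_nhdsGT hkk] with k hk
    exact h k ⟨hk.1.le, hk.2⟩

theorem helper_null (D₁ D₂ : Set (EuclideanSpace ℝ (Fin 3)))
    (hD₁o : IsOpen D₁) (a : EuclideanSpace ℝ (Fin 3))
    (h : (volume.restrict D₁).map (fun y => (⟪a, y⟫ : ℝ))
      = (volume.restrict D₂).map (fun y => (⟪a, y⟫ : ℝ)))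
    (U : Set ℝ) (hU : IsOpen U) (h2 : ∀ z ∈ D₂, (⟪a, z⟫ : ℝ) ∉ U) :
    ∀ z ∈ D₁, (⟪a, z⟫ : ℝ) ∉ U := by
  intro z hz hzU
  have hc : Continuous fun y => (⟪a, y⟫ : ℝ) := by fun_prop
  have e := congrArg (fun m => m U) h
  simp only [Measure.map_apply hc.measurable hU.measurableSet,
    Measure.restrict_apply (hc.measurable hU.measurableSet)] at e
  have e2 : (fun y => (⟪a, y⟫ : ℝ)) ⁻¹' U ∩ D₂ = ∅ := by
    ext y
    simp only [Set.mem_inter_iff, Set.mem_preimage, Set.mem_empty_iff_false, iff_false]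
    exact fun hy => h2 y hy.2 hy.1
  rw [e2, measure_empty] at e
  exact (((hU.preimage hc).inter hD₁o).measure_pos volume ⟨z, hzU, hz⟩).ne' e

theorem helper_strip (D₁ D₂ : Set (EuclideanSpace ℝ (Fin 3)))
    (hD₁ne : D₁.Nonempty) (hD₁o : IsOpen D₁) (hD₁b : Bornology.IsBounded D₁)
    (hD₂ne : D₂.Nonempty) (hD₂o : IsOpen D₂) (hD₂b : Bornology.IsBounded D₂)
    (a : EuclideanSpace ℝ (Fin 3))
    (h : (volume.restrict D₁).map (fun y => (⟪a, y⟫ : ℝ))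
      = (volume.restrict D₂).map (fun y => (⟪a, y⟫ : ℝ))) :
    stripHull D₁ a = stripHull D₂ a := by
  have bdd : ∀ D : Set (EuclideanSpace ℝ (Fin 3)), Bornology.IsBounded D →
      Bornology.IsBounded ((fun z => (⟪a, z⟫ : ℝ)) '' D) := fun D hD =>
    (innerSL ℝ a).lipschitz.isBounded_image hD
  have hub : upperBounds ((fun z => (⟪a, z⟫ : ℝ)) '' D₁)
      = upperBounds ((fun z => (⟪a, z⟫ : ℝ)) '' D₂) := by
    ext c
    simp only [mem_upperBounds, Set.forall_mem_image]
    have A := helper_null D₁ D₂ hD₁o a h (Set.Ioi c) isOpen_Ioi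
    have B := helper_null D₂ D₁ hD₂o a h.symm (Set.Ioi c) isOpen_Ioi
    simp only [Set.mem_Ioi, not_lt] at A B
    exact ⟨fun x y hy => B (fun z hz => x hz) y hy, fun x y hy => A (fun z hz => x hz) y hy⟩
  have hlb : lowerBounds ((fun z => (⟪a, z⟫ : ℝ)) '' D₁)
      = lowerBounds ((fun z => (⟪a, z⟫ : ℝ)) '' D₂) := by
    ext c
    simp only [mem_lowerBounds, Set.forall_mem_image]
    have A := helper_null D₁ D₂ hD₁o a h (Set.Iio c) isOpen_Iio
    have B := helper_null D₂ D₁ hD₂o a h.symm (Set.Iio c) isOpen_Iio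
    simp only [Set.mem_Iio, not_lt] at A B
    exact ⟨fun x y hy => B (fun z hz => x hz) y hy, fun x y hy => A (fun z hz => x hz) y hy⟩
  have hs : sSup ((fun z => (⟪a, z⟫ : ℝ)) '' D₁) = sSup ((fun z => (⟪a, z⟫ : ℝ)) '' D₂) := by
    have l1 := isLUB_csSup (hD₁ne.image _) (bdd D₁ hD₁b).bddAbove
    have l2 := isLUB_csSup (hD₂ne.image _) (bdd D₂ hD₂b).bddAbove
    unfold IsLUB at l1 l2
    rw [hub] at l1
    exact l1.unique l2
  have hi : sInf ((fun z => (⟪a, z⟫ : ℝ)) '' D₁) = sInf ((fun z => (⟪a, z⟫ : ℝ)) '' D₂) := by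
    have l1 := isGLB_csInf (hD₁ne.image _) (bdd D₁ hD₁b).bddBelow
    have l2 := isGLB_csInf (hD₂ne.image _) (bdd D₂ hD₂b).bddBelow
    unfold IsGLB at l1 l2
    rw [hlb] at l1
    exact l1.unique l2
  unfold stripHull
  rw [hs, hi]

/-- corollary on the parallel hexahedron: if for three linearly independent
normals `a₁, a₂, a₃` the integrals `∫_{D₁} e^{ik(aⱼ·y)} dy` and `∫_{D₂} e^{ik(aⱼ·y)} dy`
coincide for all `k` in the band `[k_min, k_max]`, then the smallest parallel hexahedra
with these normals containing `D₁` and `D₂` coincide. -/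
theorem hexahedron_uniqueness
    (D₁ D₂ : Set (EuclideanSpace ℝ (Fin 3)))
    (hD₁ne : D₁.Nonempty) (hD₁o : IsOpen D₁) (hD₁b : Bornology.IsBounded D₁)
    (hD₂ne : D₂.Nonempty) (hD₂o : IsOpen D₂) (hD₂b : Bornology.IsBounded D₂)
    (a : Fin 3 → EuclideanSpace ℝ (Fin 3)) (ha : LinearIndependent ℝ a)
    (kmin kmax : ℝ) (hk0 : 0 < kmin) (hkk : kmin < kmax)
    (h : ∀ j : Fin 3, ∀ k ∈ Set.Icc kmin kmax,
      (∫ y in D₁, Complex.exp (I * k * (⟪a j, y⟫ : ℝ)))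
        = ∫ y in D₂, Complex.exp (I * k * (⟪a j, y⟫ : ℝ))) :
    (⋂ j : Fin 3, stripHull D₁ (a j)) = ⋂ j : Fin 3, stripHull D₂ (a j) := by
  refine Set.iInter_congr fun j => ?_
  exact helper_strip D₁ D₂ hD₁ne hD₁o hD₁b hD₂ne hD₂o hD₂b (a j)
    (helper_map D₁ D₂ hD₁o hD₁b hD₂o hD₂b (a j) kmin kmax hkk (h j))
end
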